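/- arXiv:1512.03728 — 8 statements merged into one kernel-verified Lean document; each statement's English description precedes it below -/
import Mathlib

section
/- If (7/12)·|x|/N⁴ < 1, then there exists a real number X between 0 and x/N⁴ such that E(x) = −(77/2048)·{ (1 + X)^(−15/4) − (28/33)·1/(1 + (7/12)·x/N⁴) }·x⁴/N¹⁵. -/
/-- Third-order Taylor expansion of `(1 + t) ^ (1 / 4)` at `0` with Lagrange remainder. -/
theorem rpow_quarter_taylor (t : ℝ) (ht : -1 < t) :
    ∃ X ∈ Set.uIcc 0 t,
      (1 + t) ^ ((1 : ℝ) / 4) =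
        1 + t / 4 - 3 / 32 * t ^ 2 + 7 / 128 * t ^ 3
          - 77 / 2048 * (1 + X) ^ (-(15 : ℝ) / 4) * t ^ 4 := by
  rcases eq_or_ne t 0 with rfl | h0
  · exact ⟨0, by simp, by simp⟩
  have hpos : ∀ y ∈ Set.uIcc (1 : ℝ) (1 + t), 0 < y := fun y hy =>
    (lt_min one_pos (by linarith)).trans_le hy.1
  have hne : (1 : ℝ) ≠ 1 + t := by simpa using h0
  have hf : ContDiffOn ℝ (3 + 1) (fun y : ℝ => y ^ ((1 : ℝ) / 4)) (Set.uIcc 1 (1 + t)) :=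
    fun y hy => (Real.contDiffAt_rpow_const_of_ne (hpos y hy).ne').contDiffWithinAt
  obtain ⟨y, hy, hyeq⟩ := taylor_mean_remainder_lagrange_iteratedDeriv (n := 3) hne hf
  have hunique : UniqueDiffOn ℝ (Set.uIcc 1 (1 + t)) :=
    uniqueDiffOn_Icc (by simpa using h0)
  have hcoeff (k : ℕ) :
      iteratedDerivWithin k (fun y : ℝ => y ^ ((1 : ℝ) / 4)) (Set.uIcc 1 (1 + t)) 1 =
        (descPochhammer ℝ k).eval ((1 : ℝ) / 4) := by
    rw [iteratedDerivWithin_eq_iteratedDeriv hunique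
      (Real.contDiffAt_rpow_const_of_ne one_ne_zero) Set.left_mem_uIcc,
      iteratedDeriv_eq_iterate, Real.iter_deriv_rpow_const]
    simp
  have hyI := Set.uIoo_subset_uIcc_self hy
  refine ⟨y - 1, ?_, ?_⟩
  · rw [Set.mem_uIcc] at hyI ⊢
    rcases hyI with h | h
    · exact Or.inl ⟨by linarith [h.1], by linarith [h.2]⟩
    · exact Or.inr ⟨by linarith [h.1], by linarith [h.2]⟩
  · rw [taylor_within_apply, iteratedDeriv_eq_iterate, Real.iter_deriv_rpow_const] at hyeq
    simp only [Finset.sum_range_succ, Finset.sum_range_zero, hcoeff, descPochhammer_succ_eval,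
      descPochhammer_zero, Polynomial.eval_one, Nat.factorial, smul_eq_mul] at hyeq
    norm_num at hyeq
    norm_num
    linarith

/-- Let `N > 0`, `M = N⁴ + x > 0`, `S = (51/56)N + (5/56)M/N³ + 27Nx/(14(7M+5N⁴))`
and `E = M^(1/4) - S`.  If `(7/12)|x|/N⁴ < 1`, then there exists `X` between `0`
and `x/N⁴` with
`E = -(77/2048)·((1+X)^(-15/4) - (28/33)/(1+(7/12)x/N⁴))·x⁴/N¹⁵`. -/
theorem stmt_1 (N x : ℝ) (hN : 0 < N) (hM : 0 < N ^ 4 + x)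
    (h : (7 / 12) * |x| / N ^ 4 < 1) :
    ∃ X : ℝ,
      X ∈ Set.Icc (min 0 (x / N ^ 4)) (max 0 (x / N ^ 4)) ∧
      (N ^ 4 + x) ^ ((1 : ℝ) / 4)
          - ((51 / 56) * N + (5 / 56) * (N ^ 4 + x) / N ^ 3
              + 27 * N * x / (14 * (7 * (N ^ 4 + x) + 5 * N ^ 4)))
        = -(77 / 2048) * ((1 + X) ^ (-(15 : ℝ) / 4)
            - (28 / 33) * (1 / (1 + (7 / 12) * x / N ^ 4))) * x ^ 4 / N ^ 15 := by
  have hN4 : 0 < N ^ 4 := by positivity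
  set t := x / N ^ 4 with ht
  have hx : x = t * N ^ 4 := by rw [ht]; field_simp
  have ht1 : -1 < t := by
    rw [ht, lt_div_iff₀ hN4]; linarith
  obtain ⟨X, hX, hTaylor⟩ := rpow_quarter_taylor t ht1
  refine ⟨X, hX, ?_⟩
  have hroot : (N ^ 4 + x) ^ ((1 : ℝ) / 4) = N * (1 + t) ^ ((1 : ℝ) / 4) := by
    have hfac : N ^ 4 + x = N ^ 4 * (1 + t) := by rw [hx]; ring
    have hNroot : (N ^ 4) ^ ((1 : ℝ) / 4) = N := by
      simpa using Real.pow_rpow_inv_natCast hN.le (four_ne_zero)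
    rw [hfac, Real.mul_rpow hN4.le (by linarith), hNroot]
  rw [hroot, hTaylor]
  generalize (1 + X) ^ (-(15 : ℝ) / 4) = c
  clear_value t
  subst hx
  have h1 : 7 * (N ^ 4 + t * N ^ 4) + 5 * N ^ 4 = N ^ 4 * (12 + 7 * t) := by ring
  have h2 : 1 + 7 / 12 * (t * N ^ 4) / N ^ 4 = (12 + 7 * t) / 12 := by
    field_simp
  have hden : 12 + t * 7 ≠ 0 := by linarith
  rw [h1, h2]
  field_simp
  ring
end

section
/- If −20/77 < x/N⁴ ≤ 533/10000, then the surd approximation overestimates the true value of the fourth root, i.e. E(x) < 0 whenever x ≠ 0 (equivalently S(x) > M^(1/4) for x ≠ 0). -/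
/-- The rational function `(96 + 80t + 5t²) / (8(12 + 7t))` strictly overestimates the fourth root
of `1 + t`, in polynomial form. -/
theorem quartic_lt_of_ne_zero {t : ℝ} (ht : -20 / 77 < t) (ht0 : t ≠ 0) :
    (8 * (12 + 7 * t)) ^ 4 * (1 + t) < (96 + 80 * t + 5 * t ^ 2) ^ 4 := by
  have hq : 0 < 1935360 + 2709504 * t + t ^ 2 * (1008000 + 40000 * t + 625 * t ^ 2) := by
    have h : 0 ≤ t ^ 2 * (1008000 + 40000 * t + 625 * t ^ 2) :=
      mul_nonneg (sq_nonneg t) (by linarith [sq_nonneg t])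
    linarith
  have ht4 : 0 < t ^ 4 := by positivity
  linear_combination mul_pos ht4 hq


/-- Let `N > 0`, `M = N⁴ + x > 0`.  If `-20/77 < x/N⁴ ≤ 533/10000` and `x ≠ 0`,
then the surd approximation `S = (51/56)N + (5/56)M/N³ + 27Nx/(14(7M+5N⁴))`
overestimates the fourth root: `E = M^(1/4) - S < 0`. -/
theorem stmt_2 (N x : ℝ) (hN : 0 < N) (hM : 0 < N ^ 4 + x)
    (h1 : -20 / 77 < x / N ^ 4) (h2 : x / N ^ 4 ≤ 533 / 10000) (hx : x ≠ 0) :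
    (N ^ 4 + x) ^ ((1 : ℝ) / 4)
        - ((51 / 56) * N + (5 / 56) * (N ^ 4 + x) / N ^ 3
            + 27 * N * x / (14 * (7 * (N ^ 4 + x) + 5 * N ^ 4))) < 0 := by
  obtain ⟨t, rfl⟩ : ∃ t, x = t * N ^ 4 := ⟨x / N ^ 4, by field_simp⟩
  have hN4 : 0 < N ^ 4 := by positivity
  rw [mul_div_cancel_right₀ _ hN4.ne'] at h1
  have ht0 : t ≠ 0 := left_ne_zero_of_mul hx
  have hd : 0 < 12 + 7 * t := by linarith
  have hd0 : 12 + 7 * t ≠ 0 := hd.ne'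
  have hn : 0 < 96 + 80 * t + 5 * t ^ 2 := by linarith [sq_nonneg t]
  have hS : (51 / 56) * N + (5 / 56) * (N ^ 4 + t * N ^ 4) / N ^ 3
      + 27 * N * (t * N ^ 4) / (14 * (7 * (N ^ 4 + t * N ^ 4) + 5 * N ^ 4))
      = N * ((96 + 80 * t + 5 * t ^ 2) / (8 * (12 + 7 * t))) := by
    rw [show 7 * (N ^ 4 + t * N ^ 4) + 5 * N ^ 4 = N ^ 4 * (12 + 7 * t) by ring]
    generalize hdt : 12 + 7 * t = d at hd0
    field_simp
    rw [← hdt]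
    ring
  rw [hS, sub_neg]
  refine lt_of_pow_lt_pow_left₀ 4 (by positivity) ?_
  rw [← Real.rpow_natCast, ← Real.rpow_mul hM.le]
  norm_num only [Nat.cast_ofNat, one_div, Real.rpow_one]
  rw [mul_pow, div_pow, show N ^ 4 + t * N ^ 4 = N ^ 4 * (1 + t) by ring]
  refine mul_lt_mul_of_pos_left ?_ hN4
  rw [lt_div_iff₀ (by positivity), mul_comm]
  exact quartic_lt_of_ne_zero h1 ht0
end

section
/- For every real number t with 0 < t ≤ 533/10000, one has (1 + t)^(−15/4) − (28/33)·1/(1 + (7/12)·t) > 0. -/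
theorem rpow_fifteen_fourths_lt :
    (10533 / 10000 : ℝ) ^ ((15 : ℝ) / 4) < 33 / 28 * (1 + 7 / 12 * (533 / 10000)) := by
  refine lt_of_pow_lt_pow_left₀ 4 (by norm_num) ?_
  rw [← Real.rpow_natCast, ← Real.rpow_mul (by norm_num),
    show (15 : ℝ) / 4 * ((4 : ℕ) : ℝ) = ((15 : ℕ) : ℝ) by norm_num, Real.rpow_natCast]
  norm_num

/-- For every real `t` with `0 < t ≤ 533/10000`, one has
`(1+t)^(-15/4) - (28/33)/(1+(7/12)t) > 0`. -/
theorem stmt_3 (t : ℝ) (h0 : 0 < t) (h1 : t ≤ 533 / 10000) :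
    (1 + t) ^ (-(15 : ℝ) / 4) - (28 / 33) * (1 / (1 + (7 / 12) * t)) > 0 := by
  have hconv := convexOn_rpow (p := (15 : ℝ) / 4) (by norm_num)
  have hone : (1 : ℝ) ∈ Set.Ici (0 : ℝ) := Set.mem_Ici.2 (by norm_num)
  have hright : (10533 / 10000 : ℝ) ∈ Set.Ici (0 : ℝ) := Set.mem_Ici.2 (by norm_num)
  have hchord := hconv.2 hone hright
    (by linarith : (0 : ℝ) ≤ 1 - 10000 / 533 * t)
    (by positivity : (0 : ℝ) ≤ 10000 / 533 * t) (by ring)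
  simp only [smul_eq_mul, Real.one_rpow] at hchord
  rw [show (1 - 10000 / 533 * t) * 1 + 10000 / 533 * t * (10533 / 10000) = 1 + t by ring]
    at hchord
  have hend := mul_lt_mul_of_pos_left rpow_fifteen_fourths_lt
    (by positivity : 0 < 10000 / 533 * t)
  have hpos : 0 < (1 + t) ^ ((15 : ℝ) / 4) := Real.rpow_pos_of_pos (by linarith) _
  have hlt : 28 / 33 * (1 + t) ^ ((15 : ℝ) / 4) < 1 + 7 / 12 * t := by linarith
  rw [gt_iff_lt, sub_pos, neg_div, Real.rpow_neg (by linarith), ← one_div, mul_one_div,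
    div_lt_div_iff₀ (by positivity) hpos]
  linarith
end

section
/- If N ≠ 0 and 1 + (7/12)·x/N⁴ ≠ 0, then S(x) = N·{ 1 + (1/4)·x/N⁴ − (3/32)·x²/N⁸ + (7/128)·x³/N¹² − (49/1536)·(x⁴/N¹⁶)·1/(1 + (7/12)·x/N⁴) }. -/
/-- With `M = N⁴ + x`, if `N ≠ 0` and `1 + (7/12)x/N⁴ ≠ 0`, then the surd
approximation `S = (51/56)N + (5/56)M/N³ + 27Nx/(14(7M+5N⁴))` equals
`N·(1 + x/(4N⁴) - 3x²/(32N⁸) + 7x³/(128N¹²) - (49/1536)(x⁴/N¹⁶)/(1+(7/12)x/N⁴))`. -/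
theorem stmt_5 (N x : ℝ) (hN : N ≠ 0) (h : 1 + (7 / 12) * x / N ^ 4 ≠ 0) :
    (51 / 56) * N + (5 / 56) * (N ^ 4 + x) / N ^ 3
        + 27 * N * x / (14 * (7 * (N ^ 4 + x) + 5 * N ^ 4))
      = N * (1 + (1 / 4) * x / N ^ 4 - (3 / 32) * x ^ 2 / N ^ 8
          + (7 / 128) * x ^ 3 / N ^ 12
          - (49 / 1536) * (x ^ 4 / N ^ 16) * (1 / (1 + (7 / 12) * x / N ^ 4))) := by
  obtain ⟨t, rfl⟩ : ∃ t, x = t * N ^ 4 := ⟨x / N ^ 4, by field_simp⟩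
  have ht : 1 + 7 / 12 * (t * N ^ 4) / N ^ 4 = (12 + 7 * t) / 12 := by
    field_simp
  rw [ht] at h ⊢
  have h' : 12 + 7 * t ≠ 0 := fun h0 => h (by rw [h0, zero_div])
  have hden : 14 * (7 * (N ^ 4 + t * N ^ 4) + 5 * N ^ 4) = 14 * N ^ 4 * (12 + 7 * t) := by
    ring
  rw [hden]
  obtain ⟨d, hd⟩ : ∃ d, d = 12 + 7 * t := ⟨_, rfl⟩
  obtain rfl : t = (d - 12) / 7 := by linarith
  rw [← hd] at h' ⊢
  field_simp
  ring
end

section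
/- Let p > 0 and suppose 0 < x < (p/100)·N⁴ (so M exceeds N⁴ by less than p percent of N⁴). Then |E(x)| < (77/2048)·{ 1 − (28/33)·1/(1 + (7/12)·(p/100)) }·(p/100)⁴·N. -/
/-- The surd approximation to `(1 + t)^(1/4)`, i.e. the case `N = 1`. -/
noncomputable def unitSurd (t : ℝ) : ℝ :=
  1 + 5 / 56 * t + 27 * t / (14 * (12 + 7 * t))

/-- The error bound for the surd approximation, for `N = 1`. -/
noncomputable def unitSurdBound (t : ℝ) : ℝ :=
  (77 / 2048) * (1 - (28 / 33) * (1 / (1 + (7 / 12) * t))) * t ^ 4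

lemma unitSurdBound_lt {s t : ℝ} (hs : 0 < s) (hst : s < t) :
    unitSurdBound s < unitSurdBound t := by
  unfold unitSurdBound
  have hinv : 1 / (1 + (7 / 12) * t) ≤ 1 / (1 + (7 / 12) * s) :=
    one_div_le_one_div_of_le (by positivity) (by linarith)
  have hone : 1 / (1 + (7 / 12) * s) ≤ 1 := by
    rw [div_le_one (by positivity)]
    linarith
  have hpow : s ^ 4 < t ^ 4 := pow_lt_pow_left₀ hst hs.le (by norm_num)
  exact mul_lt_mul' (by linarith) hpow (by positivity) (by linarith)

lemma le_unitSurd {v : ℝ} (hv : 0 < v) : 1 + v ≤ unitSurd ((1 + v) ^ 4 - 1) := by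
  have hd : 0 < 12 + 7 * ((1 + v) ^ 4 - 1) := by
    ring_nf
    positivity
  have combine (t : ℝ) (h : 12 + 7 * t ≠ 0) : unitSurd t - (1 + v) =
      (5 * t * (12 + 7 * t) + 108 * t - 56 * v * (12 + 7 * t)) / (56 * (12 + 7 * t)) := by
    unfold unitSurd
    generalize 12 + 7 * t = d at h ⊢
    field_simp
    ring
  have key : 5 * ((1 + v) ^ 4 - 1) * (12 + 7 * ((1 + v) ^ 4 - 1)) + 108 * ((1 + v) ^ 4 - 1)
      - 56 * v * (12 + 7 * ((1 + v) ^ 4 - 1)) =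
      980 * v ^ 4 + 1568 * v ^ 5 + 980 * v ^ 6 + 280 * v ^ 7 + 35 * v ^ 8 := by ring
  have : 0 ≤ unitSurd ((1 + v) ^ 4 - 1) - (1 + v) := by
    rw [combine _ hd.ne', key]
    positivity
  linarith

lemma unitSurd_sub_lt {v : ℝ} (hv : 0 < v) :
    unitSurd ((1 + v) ^ 4 - 1) - (1 + v) < unitSurdBound ((1 + v) ^ 4 - 1) := by
  have taylor (t : ℝ) (ht : 0 < t) : unitSurd t - unitSurdBound t =
      1 + t / 4 - 3 / 32 * t ^ 2 + 7 / 128 * t ^ 3 - 77 / 2048 * t ^ 4 := by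
    unfold unitSurd unitSurdBound
    have h' : 1 + 7 / 12 * t = (12 + 7 * t) / 12 := by ring
    rw [h']
    field_simp
    ring
  have ht : 0 < (1 + v) ^ 4 - 1 := by
    ring_nf
    positivity
  have hpos : 0 < 59136 * v ^ 5 + 256256 * v ^ 6 + 556160 * v ^ 7 + 784080 * v ^ 8
      + 788480 * v ^ 9 + 588896 * v ^ 10 + 331296 * v ^ 11 + 139720 * v ^ 12
      + 43120 * v ^ 13 + 9240 * v ^ 14 + 1232 * v ^ 15 + 77 * v ^ 16 := by positivity
  linarith [taylor _ ht]

lemma abs_sub_unitSurd_lt {v q : ℝ} (hv : 0 < v) (hq : (1 + v) ^ 4 - 1 < q) :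
    |1 + v - unitSurd ((1 + v) ^ 4 - 1)| < unitSurdBound q := by
  have ht : 0 < (1 + v) ^ 4 - 1 := by
    ring_nf
    positivity
  rw [abs_sub_comm, abs_of_nonneg (sub_nonneg.2 (le_unitSurd hv))]
  exact (unitSurd_sub_lt hv).trans (unitSurdBound_lt ht hq)

/-- Let `N > 0`, `M = N⁴ + x`, `p > 0`, and suppose `0 < x < (p/100)N⁴`.  Then the
error `E = M^(1/4) - S` of the surd approximation
`S = (51/56)N + (5/56)M/N³ + 27Nx/(14(7M+5N⁴))` satisfies
`|E| < (77/2048)·(1 - (28/33)/(1+(7/12)(p/100)))·(p/100)⁴·N`. -/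
theorem stmt_6 (N x p : ℝ) (hN : 0 < N) (hp : 0 < p)
    (hx0 : 0 < x) (hx1 : x < (p / 100) * N ^ 4) :
    |(N ^ 4 + x) ^ ((1 : ℝ) / 4)
        - ((51 / 56) * N + (5 / 56) * (N ^ 4 + x) / N ^ 3
            + 27 * N * x / (14 * (7 * (N ^ 4 + x) + 5 * N ^ 4)))|
      < (77 / 2048) * (1 - (28 / 33) * (1 / (1 + (7 / 12) * (p / 100))))
          * (p / 100) ^ 4 * N := by
  have hM : 0 < N ^ 4 + x := by positivity
  obtain ⟨r, hr⟩ : ∃ r, r = (N ^ 4 + x) ^ ((1 : ℝ) / 4) := ⟨_, rfl⟩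
  have hr0 : 0 < r := hr ▸ Real.rpow_pos_of_pos hM _
  have hr4 : r ^ 4 = N ^ 4 + x := by
    rw [hr, ← Real.rpow_natCast, ← Real.rpow_mul hM.le]
    norm_num
  have hNr : N < r := lt_of_pow_lt_pow_left₀ 4 hr0.le (by linarith)
  rw [← hr]
  obtain ⟨v, rfl⟩ : ∃ v, r = N * (1 + v) := ⟨r / N - 1, by field_simp; ring⟩
  have hv : 0 < v := by
    by_contra! h
    nlinarith
  obtain rfl : x = N ^ 4 * ((1 + v) ^ 4 - 1) := by linear_combination -hr4
  have hq : (1 + v) ^ 4 - 1 < p / 100 := by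
    rw [mul_comm (p / 100)] at hx1
    exact lt_of_mul_lt_mul_left hx1 (by positivity)
  have hscale : (51 / 56) * N + (5 / 56) * (N ^ 4 + N ^ 4 * ((1 + v) ^ 4 - 1)) / N ^ 3
      + 27 * N * (N ^ 4 * ((1 + v) ^ 4 - 1)) /
        (14 * (7 * (N ^ 4 + N ^ 4 * ((1 + v) ^ 4 - 1)) + 5 * N ^ 4))
      = N * unitSurd ((1 + v) ^ 4 - 1) := by
    have hden : 7 * (N ^ 4 + N ^ 4 * ((1 + v) ^ 4 - 1)) + 5 * N ^ 4
        = N ^ 4 * (12 + 7 * ((1 + v) ^ 4 - 1)) := by ring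
    rw [hden]
    unfold unitSurd
    field_simp
    ring
  rw [hscale, ← mul_sub, abs_mul, abs_of_pos hN, mul_comm N]
  exact mul_lt_mul_of_pos_right (abs_sub_unitSurd_lt hv hq) hN
end

section
/- Let p > 0 and suppose x < 0 and |x| < (p/100)·M (so N⁴ exceeds M by less than p percent of M). Then |E(x)| < (77/2048)·{ (1 + p/100)^(15/4) − 28/33 }·(p/(100 + p))⁴·N. -/
/-- The surd approximation minus the fourth root, for `N = 1` and `M = s ^ 4`. -/
lemma surd_sub_root_eq (s : ℝ) :
    51 / 56 + 5 / 56 * s ^ 4 + 27 * (s ^ 4 - 1) / (14 * (7 * s ^ 4 + 5)) - s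
      = (1 - s) ^ 4 * (147 + 308 * s + 350 * s ^ 2 + 140 * s ^ 3 + 35 * s ^ 4)
          / (56 * (7 * s ^ 4 + 5)) := by
  have h : 7 * s ^ 4 + 5 ≠ 0 := by positivity
  field_simp
  ring

lemma surd_sub_root_nonneg {s : ℝ} (hs : 0 < s) :
    0 ≤ 51 / 56 + 5 / 56 * s ^ 4 + 27 * (s ^ 4 - 1) / (14 * (7 * s ^ 4 + 5)) - s := by
  rw [surd_sub_root_eq]
  positivity

lemma surd_sub_root_le {s : ℝ} (hs : 0 < s) (hs1 : s ≤ 1) :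
    51 / 56 + 5 / 56 * s ^ 4 + 27 * (s ^ 4 - 1) / (14 * (7 * s ^ 4 + 5)) - s
      ≤ 77 / 2048 * ((s ^ 15)⁻¹ - 28 / 33) * (1 - s ^ 4) ^ 4 := by
  rw [surd_sub_root_eq, ← sub_nonneg]
  have h : 7 * s ^ 4 + 5 ≠ 0 := by positivity
  have key : 77 / 2048 * ((s ^ 15)⁻¹ - 28 / 33) * (1 - s ^ 4) ^ 4
      - (1 - s) ^ 4 * (147 + 308 * s + 350 * s ^ 2 + 140 * s ^ 3 + 35 * s ^ 4)
          / (56 * (7 * s ^ 4 + 5))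
      = (1 - s) ^ 5 * (64680 * s ^ 0 + 323400 * s ^ 1 + 970200 * s ^ 2 + 2263800 * s ^ 3 + 4359432 * s ^ 4
          + 7308840 * s ^ 5 + 11060280 * s ^ 6 + 15458520 * s ^ 7 + 20270712 * s ^ 8 + 25186392 * s ^ 9
          + 29817480 * s ^ 10 + 33698280 * s ^ 11 + 36570072 * s ^ 12 + 38381112 * s ^ 13 + 39286632 * s ^ 14
          + 38690792 * s ^ 15 + 36669472 * s ^ 16 + 33970272 * s ^ 17 + 32012512 * s ^ 18 + 30019360 * s ^ 19
          + 27516832 * s ^ 20 + 24333792 * s ^ 21 + 20601952 * s ^ 22 + 16518880 * s ^ 23 + 12348000 * s ^ 24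
          + 8418592 * s ^ 25 + 5125792 * s ^ 26 + 2689120 * s ^ 27 + 1152480 * s ^ 28 + 384160 * s ^ 29
          + 76832 * s ^ 30)
          / (6144 * 56 * s ^ 15 * (7 * s ^ 4 + 5)) := by
    field_simp
    ring
  have h1 : 0 ≤ 1 - s := sub_nonneg.2 hs1
  rw [key]
  positivity


/-- Let `N > 0`, `M = N⁴ + x > 0`, `p > 0`, and suppose `x < 0` and
`|x| < (p/100)·M`.  Then the error `E = M^(1/4) - S` of the surd approximation
`S = (51/56)N + (5/56)M/N³ + 27Nx/(14(7M+5N⁴))` satisfies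
`|E| < (77/2048)·((1+p/100)^(15/4) - 28/33)·(p/(100+p))⁴·N`. -/
theorem stmt_7 (N x p : ℝ) (hN : 0 < N) (hp : 0 < p) (hM : 0 < N ^ 4 + x)
    (hx0 : x < 0) (hx1 : |x| < (p / 100) * (N ^ 4 + x)) :
    |(N ^ 4 + x) ^ ((1 : ℝ) / 4)
        - ((51 / 56) * N + (5 / 56) * (N ^ 4 + x) / N ^ 3
            + 27 * N * x / (14 * (7 * (N ^ 4 + x) + 5 * N ^ 4)))|
      < (77 / 2048) * ((1 + p / 100) ^ ((15 : ℝ) / 4) - 28 / 33)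
          * (p / (100 + p)) ^ 4 * N := by
  set M := N ^ 4 + x with hMdef
  obtain ⟨s, hs, hsM⟩ : ∃ s : ℝ, 0 < s ∧ M ^ ((1 : ℝ) / 4) = N * s :=
    ⟨M ^ ((1 : ℝ) / 4) / N, by positivity, by field_simp⟩
  have hM4 : M = N ^ 4 * s ^ 4 := by
    rw [← mul_pow, ← hsM, ← Real.rpow_natCast, ← Real.rpow_mul hM.le]
    norm_num
  have hx : x = N ^ 4 * (s ^ 4 - 1) := by linarith
  have hN4 : 0 < N ^ 4 := by positivity
  have hs4 : s ^ 4 < 1 := by nlinarith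
  have hs1 : s < 1 := lt_of_pow_lt_pow_left₀ 4 zero_le_one (by simpa using hs4)
  have hq : (s ^ 4)⁻¹ < 1 + p / 100 := by
    rw [abs_of_neg hx0, hM4, hx] at hx1
    rw [inv_lt_iff_one_lt_mul₀ (by positivity)]
    nlinarith
  have hpow : (s ^ 15)⁻¹ < (1 + p / 100) ^ ((15 : ℝ) / 4) := by
    have h : (s ^ 15)⁻¹ = ((s ^ 4)⁻¹) ^ ((15 : ℝ) / 4) := by
      rw [Real.inv_rpow (by positivity), ← Real.rpow_natCast s 4, ← Real.rpow_mul hs.le,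
        ← Real.rpow_natCast s 15]
      norm_num
    rw [h]
    exact Real.rpow_lt_rpow (by positivity) hq (by norm_num)
  have hfrac : 1 - s ^ 4 < p / (100 + p) := by
    rw [inv_lt_iff_one_lt_mul₀ (by positivity)] at hq
    rw [lt_div_iff₀ (by positivity)]
    nlinarith
  have hone : 1 ≤ (s ^ 15)⁻¹ := (one_le_inv₀ (by positivity)).2 (pow_le_one₀ hs.le hs1.le)
  have hE : M ^ ((1 : ℝ) / 4) - ((51 / 56) * N + (5 / 56) * M / N ^ 3
        + 27 * N * x / (14 * (7 * M + 5 * N ^ 4)))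
      = -((51 / 56 + 5 / 56 * s ^ 4 + 27 * (s ^ 4 - 1) / (14 * (7 * s ^ 4 + 5)) - s) * N) := by
    have h : 7 * s ^ 4 + 5 ≠ 0 := by positivity
    have hden : 7 * (N ^ 4 * s ^ 4) + 5 * N ^ 4 = N ^ 4 * (7 * s ^ 4 + 5) := by ring
    rw [hsM, hM4, hx, hden]
    field_simp
    ring
  rw [hE, abs_neg, abs_of_nonneg (mul_nonneg (surd_sub_root_nonneg hs) hN.le)]
  refine mul_lt_mul_of_pos_right ((surd_sub_root_le hs hs1.le).trans_lt ?_) hN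
  have hd : 0 < 1 - s ^ 4 := sub_pos.2 hs4
  have hc : 0 < (s ^ 15)⁻¹ - 28 / 33 := by linarith
  gcongr
end

section
/- If 0 < x < N⁴/100 (i.e. M exceeds N⁴ by less than 1 percent of N⁴), then |E(x)| < N/17000000000. -/
/-- A Padé-type rational function approximates `(1 + t) ^ (1 / 4)` from above near `0`. -/
lemma fourth_root_approx {t y : ℝ} (ht0 : 0 < t) (ht1 : t < 1 / 100) (hy : 0 < y)
    (hyt : y ^ 4 = 1 + t) :
    |y - (96 + 80 * t + 5 * t ^ 2) / (8 * (12 + 7 * t))| < 1 / 17000000000 := by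
  set s := (96 + 80 * t + 5 * t ^ 2) / (8 * (12 + 7 * t)) with hs
  have hs0 : 0 < s := by positivity
  have hdiff : s ^ 4 - y ^ 4 =
      t ^ 4 * (1935360 + 2709504 * t + 1008000 * t ^ 2 + 40000 * t ^ 3 + 625 * t ^ 4)
        / (8 * (12 + 7 * t)) ^ 4 := by
    rw [hyt, hs]
    field_simp
    ring
  have hpos : 0 < s ^ 4 - y ^ 4 := by
    rw [hdiff]
    positivity
  have hys : y < s := lt_of_pow_lt_pow_left₀ 4 hs0.le (by linarith)
  have hy1 : 1 < y := by
    refine lt_of_pow_lt_pow_left₀ 4 hy.le ?_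
    linarith
  have hsmall : s ^ 4 - y ^ 4 < 4 / 17000000000 := by
    have ht4 : t ^ 4 < (1 / 100) ^ 4 := pow_lt_pow_left₀ ht1 ht0.le (by norm_num)
    have hnum : 1935360 + 2709504 * t + 1008000 * t ^ 2 + 40000 * t ^ 3 + 625 * t ^ 4
        ≤ 1962600 := by
      have ht2 : t ^ 2 ≤ (1 / 100) ^ 2 := pow_le_pow_left₀ ht0.le ht1.le 2
      have ht3 : t ^ 3 ≤ (1 / 100) ^ 3 := pow_le_pow_left₀ ht0.le ht1.le 3
      linarith
    have hden : (96 : ℝ) ^ 4 ≤ (8 * (12 + 7 * t)) ^ 4 :=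
      pow_le_pow_left₀ (by norm_num) (by linarith) 4
    rw [hdiff]
    calc _ ≤ (1 / 100) ^ 4 * 1962600 / (96 : ℝ) ^ 4 := by gcongr
      _ < 4 / 17000000000 := by norm_num
  have hfactor : 4 * (s - y) ≤ s ^ 4 - y ^ 4 := by
    have h : 4 ≤ s ^ 3 + s ^ 2 * y + s * y ^ 2 + y ^ 3 := by
      have hs1 : 1 ≤ s := by linarith
      have h1 := one_le_pow₀ hs1 (n := 3)
      have h2 := one_le_mul_of_one_le_of_one_le (one_le_pow₀ hs1 (n := 2)) hy1.le
      have h3 := one_le_mul_of_one_le_of_one_le hs1 (one_le_pow₀ hy1.le (n := 2))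
      have h4 := one_le_pow₀ hy1.le (n := 3)
      linarith
    calc 4 * (s - y) ≤ (s ^ 3 + s ^ 2 * y + s * y ^ 2 + y ^ 3) * (s - y) :=
          mul_le_mul_of_nonneg_right h (by linarith)
      _ = s ^ 4 - y ^ 4 := by ring
  rw [abs_lt]
  constructor <;> linarith


/-- Let `N > 0`, `M = N⁴ + x`.  If `0 < x < N⁴/100`, then the error
`E = M^(1/4) - S` of the surd approximation
`S = (51/56)N + (5/56)M/N³ + 27Nx/(14(7M+5N⁴))` satisfies
`|E| < N/17000000000`. -/
theorem stmt_8 (N x : ℝ) (hN : 0 < N) (hx0 : 0 < x) (hx1 : x < N ^ 4 / 100) :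
    |(N ^ 4 + x) ^ ((1 : ℝ) / 4)
        - ((51 / 56) * N + (5 / 56) * (N ^ 4 + x) / N ^ 3
            + 27 * N * x / (14 * (7 * (N ^ 4 + x) + 5 * N ^ 4)))|
      < N / 17000000000 := by
  obtain ⟨t, rfl⟩ : ∃ t, x = N ^ 4 * t := ⟨x / N ^ 4, by field_simp⟩
  have hN4 : 0 < N ^ 4 := by positivity
  have ht0 : 0 < t := pos_of_mul_pos_right hx0 hN4.le
  have ht1 : t < 1 / 100 := lt_of_mul_lt_mul_left (by linarith) hN4.le
  have hroot : (N ^ 4 + N ^ 4 * t) ^ ((1 : ℝ) / 4) = N * (1 + t) ^ ((1 : ℝ) / 4) := by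
    rw [← mul_one_add, Real.mul_rpow hN4.le (by linarith), ← Real.rpow_natCast,
      ← Real.rpow_mul hN.le]
    norm_num
  have happrox := fourth_root_approx (y := (1 + t) ^ ((1 : ℝ) / 4)) ht0 ht1 (by positivity) (by
    rw [← Real.rpow_natCast, ← Real.rpow_mul (by linarith)]
    norm_num)
  have hS : (51 / 56) * N + (5 / 56) * (N ^ 4 + N ^ 4 * t) / N ^ 3
      + 27 * N * (N ^ 4 * t) / (14 * (7 * (N ^ 4 + N ^ 4 * t) + 5 * N ^ 4))
      = N * ((96 + 80 * t + 5 * t ^ 2) / (8 * (12 + 7 * t))) := by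
    have hden : 14 * (7 * (N ^ 4 + N ^ 4 * t) + 5 * N ^ 4) = N ^ 4 * (14 * (12 + 7 * t)) := by
      ring
    rw [hden]
    field_simp
    ring
  rw [hroot, hS, ← mul_sub, abs_mul, abs_of_pos hN, div_eq_mul_one_div N]
  exact mul_lt_mul_of_pos_left happrox hN
end

section
/- If x < 0 and |x| < M/100 (i.e. N⁴ exceeds M by less than 1 percent of M), then |E(x)| < N/14600000000. -/
/-- On the curve `x = (t N)⁴ - N⁴`, the error of the surd approximation is `N` times a rational
function of `t` vanishing to fourth order at `t = 1`. -/
lemma surd_error_eq (N t : ℝ) (hN : N ≠ 0) :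
    t * N - ((51 / 56) * N + (5 / 56) * (t * N) ^ 4 / N ^ 3
        + 27 * N * ((t * N) ^ 4 - N ^ 4) / (14 * (7 * (t * N) ^ 4 + 5 * N ^ 4)))
      = -(N * ((1 - t) ^ 4 * (140 - 224 * (1 - t) + 140 * (1 - t) ^ 2 - 40 * (1 - t) ^ 3
          + 5 * (1 - t) ^ 4) / (8 * (7 * t ^ 4 + 5)))) := by
  have hD : 7 * t ^ 4 + 5 ≠ 0 := by positivity
  have hfac : 7 * (t * N) ^ 4 + 5 * N ^ 4 = N ^ 4 * (7 * t ^ 4 + 5) := by ring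
  rw [hfac]
  field_simp
  ring

lemma surd_error_bound (s : ℝ) (hs0 : 0 < s) (hs1 : s < 1 / 400) :
    0 < 140 - 224 * s + 140 * s ^ 2 - 40 * s ^ 3 + 5 * s ^ 4 ∧
      s ^ 4 * (140 - 224 * s + 140 * s ^ 2 - 40 * s ^ 3 + 5 * s ^ 4)
        / (8 * (7 * (1 - s) ^ 4 + 5)) < 1 / 14600000000 := by
  have h2 : s ^ 2 < (1 / 400) ^ 2 := by gcongr
  have h3 : s ^ 3 < (1 / 400) ^ 3 := by gcongr
  have h4 : s ^ 4 < (1 / 400) ^ 4 := by gcongr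
  have p2 : 0 < s ^ 2 := by positivity
  have p3 : 0 < s ^ 3 := by positivity
  have p4 : 0 < s ^ 4 := by positivity
  have hpos : 0 < 140 - 224 * s + 140 * s ^ 2 - 40 * s ^ 3 + 5 * s ^ 4 := by
    norm_num at *
    linarith
  have hle : 140 - 224 * s + 140 * s ^ 2 - 40 * s ^ 3 + 5 * s ^ 4 < 141 := by
    norm_num at *
    linarith
  have hq : (399 / 400 : ℝ) ^ 4 < (1 - s) ^ 4 := by
    gcongr
    linarith
  have hmul : s ^ 4 * (140 - 224 * s + 140 * s ^ 2 - 40 * s ^ 3 + 5 * s ^ 4)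
      < (1 / 400) ^ 4 * 141 := by gcongr
  refine ⟨hpos, ?_⟩
  rw [div_lt_iff₀ (by positivity)]
  norm_num at *
  linarith


/-- Let `N > 0`, `M = N⁴ + x > 0`.  If `x < 0` and `|x| < M/100`, then the error
`E = M^(1/4) - S` of the surd approximation
`S = (51/56)N + (5/56)M/N³ + 27Nx/(14(7M+5N⁴))` satisfies
`|E| < N/14600000000`. -/
theorem stmt_9 (N x : ℝ) (hN : 0 < N) (hM : 0 < N ^ 4 + x)
    (hx0 : x < 0) (hx1 : |x| < (N ^ 4 + x) / 100) :
    |(N ^ 4 + x) ^ ((1 : ℝ) / 4)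
        - ((51 / 56) * N + (5 / 56) * (N ^ 4 + x) / N ^ 3
            + 27 * N * x / (14 * (7 * (N ^ 4 + x) + 5 * N ^ 4)))|
      < N / 14600000000 := by
  rw [abs_of_neg hx0] at hx1
  obtain ⟨t, ht0, ht⟩ : ∃ t : ℝ, 0 < t ∧ (N ^ 4 + x) ^ ((1 : ℝ) / 4) = t * N :=
    ⟨(N ^ 4 + x) ^ ((1 : ℝ) / 4) / N, by positivity, by field_simp⟩
  have hM4 : N ^ 4 + x = (t * N) ^ 4 := by
    rw [← ht, ← Real.rpow_natCast (_ ^ _ : ℝ) 4, ← Real.rpow_mul hM.le]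
    norm_num
  have hx : x = (t * N) ^ 4 - N ^ 4 := by linarith
  have hN4 : 0 < N ^ 4 := by positivity
  have ht1 : t < 1 := by
    by_contra! h
    have : 1 ≤ t ^ 4 := one_le_pow₀ h
    nlinarith [mul_pow t N 4]
  have ht2 : 399 / 400 < t := by
    by_contra! h
    have : t ^ 4 ≤ (399 / 400) ^ 4 := by gcongr
    norm_num at this
    nlinarith [mul_pow t N 4]
  obtain ⟨hpos, hlt⟩ := surd_error_bound (1 - t) (by linarith) (by linarith)
  rw [sub_sub_cancel] at hlt
  rw [ht, hM4, hx, surd_error_eq N t hN.ne', abs_neg, abs_of_nonneg (by positivity),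
    div_eq_mul_one_div N]
  gcongr
end
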